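/- arXiv:1803.10846 — 2 statements merged into one kernel-verified Lean document; each statement's English description precedes it below -/
import Mathlib

section
/- Fix 0 < β ≤ 1/10 and 0 < ε ≤ 1/10. Let A be a symmetric n×n matrix and ℓ < u be barrier values with u − ℓ ≤ 1 and ℓI ≺ A ≺ uI. Let ρ satisfy (1−ε)·(min{λ_min(uI−A), λ_min(A−ℓI)})² ≤ ρ ≤ (min{λ_min(uI−A), λ_min(A−ℓI)})². Set C₊ = exp((A−ℓI)^{-1})(A−ℓI)^{-2} and C₋ = exp((uI−A)^{-1})(uI−A)^{-2}. Suppose Δ is a symmetric positive semidefinite matrix with Δ ⪯ ερ I and (C₊ − C₋) • Δ ≥ (ερ/2)·((1−β−ε) tr(C₊) − (1+β+ε) tr(C₋)). Define δ_u = (ερ/2)·(1+β+5ε)/(1−2ε) and δ_ℓ = (ερ/2)·(1−β−5ε)/(1+2ε). Then Φ_{u+δ_u, ℓ+δ_ℓ}(A+Δ) ≤ Φ_{u,ℓ}(A). -/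
open scoped BigOperators
open Matrix

/-- Matrix exponential. -/
noncomputable def matExp {n : ℕ} (A : Matrix (Fin n) (Fin n) ℝ) : Matrix (Fin n) (Fin n) ℝ :=
  NormedSpace.exp A

/-- Matrix inner product `A • B = tr(AᵀB) = ∑ᵢⱼ Aᵢⱼ Bᵢⱼ`. -/
noncomputable def matInner {n : ℕ} (A B : Matrix (Fin n) (Fin n) ℝ) : ℝ :=
  ∑ i, ∑ j, A i j * B i j

/-- The minimum eigenvalue of a symmetric matrix, characterized as the largest `t`
with `tI ⪯ A`. -/
noncomputable def minEig {n : ℕ} (A : Matrix (Fin n) (Fin n) ℝ) : ℝ :=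
  sSup {t : ℝ | (A - t • (1 : Matrix (Fin n) (Fin n) ℝ)).PosSemidef}

/-- Upper barrier potential `Φ_u(A) = tr exp((uI−A)⁻¹)`. -/
noncomputable def PhiU {n : ℕ} (u : ℝ) (A : Matrix (Fin n) (Fin n) ℝ) : ℝ :=
  (matExp ((u • (1 : Matrix (Fin n) (Fin n) ℝ) - A)⁻¹)).trace

/-- Lower barrier potential `Φ_ℓ(A) = tr exp((A−ℓI)⁻¹)`. -/
noncomputable def PhiL {n : ℕ} (ℓ : ℝ) (A : Matrix (Fin n) (Fin n) ℝ) : ℝ :=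
  (matExp ((A - ℓ • (1 : Matrix (Fin n) (Fin n) ℝ))⁻¹)).trace

/-- Two-sided barrier potential `Φ_{u,ℓ}(A) = Φ_u(A) + Φ_ℓ(A)`. -/
noncomputable def Phi {n : ℕ} (u ℓ : ℝ) (A : Matrix (Fin n) (Fin n) ℝ) : ℝ :=
  PhiU u A + PhiL ℓ A

/-- The scalar barrier function `x ↦ exp (1/x)`. -/
noncomputable def barrier (x : ℝ) : ℝ := Real.exp x⁻¹

/-- The negated derivative of `barrier`. -/
noncomputable def barrierSlope (x : ℝ) : ℝ := Real.exp x⁻¹ * x⁻¹ ^ 2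

/-- The second derivative of `barrier`. -/
noncomputable def barrierCurv (x : ℝ) : ℝ := Real.exp x⁻¹ * (x⁻¹ ^ 4 + 2 * x⁻¹ ^ 3)

lemma barrierSlope_nonneg (x : ℝ) : 0 ≤ barrierSlope x := by
  unfold barrierSlope; positivity

lemma two_sub_mul_exp_le {t : ℝ} (ht : 0 ≤ t) : (2 - t) * Real.exp t ≤ 2 + t := by
  have hd : ∀ x : ℝ, HasDerivAt (fun y : ℝ => 2 + y - (2 - y) * Real.exp y)
      (1 - (1 - x) * Real.exp x) x := fun x => by
    have h := ((hasDerivAt_id x).const_add 2).sub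
      (((hasDerivAt_id x).const_sub 2).mul (Real.hasDerivAt_exp x))
    refine HasDerivAt.congr_deriv h ?_
    simp only [id]
    ring
  have hm : Monotone fun y : ℝ => 2 + y - (2 - y) * Real.exp y := by
    refine monotone_of_deriv_nonneg (fun x => (hd x).differentiableAt) fun x => ?_
    rw [(hd x).deriv, sub_nonneg]
    calc (1 - x) * Real.exp x ≤ Real.exp (-x) * Real.exp x := by
          have := Real.add_one_le_exp (-x)
          gcongr
          linarith
      _ = 1 := by rw [← Real.exp_add]; simp
  have := hm ht
  simp at this
  linarith

lemma barrier_sub_le {x y : ℝ} (hx : 0 < x) (hy : 0 < y) :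
    barrier y - barrier x ≤ barrierSlope y * (x - y) := by
  unfold barrier barrierSlope
  obtain ⟨a, ha, rfl⟩ : ∃ a : ℝ, 0 < a ∧ x = a⁻¹ := ⟨x⁻¹, by positivity, by simp⟩
  obtain ⟨b, hb, rfl⟩ : ∃ b : ℝ, 0 < b ∧ y = b⁻¹ := ⟨y⁻¹, by positivity, by simp⟩
  simp only [inv_inv]
  have h1 : Real.exp b * (1 + (a - b)) ≤ Real.exp a := by
    have : Real.exp a = Real.exp b * Real.exp (a - b) := by rw [← Real.exp_add, add_sub_cancel]
    rw [this]
    have := Real.add_one_le_exp (a - b)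
    gcongr
    linarith
  have h2 : b - a ≤ b ^ 2 * (a⁻¹ - b⁻¹) := by
    have : b ^ 2 * (a⁻¹ - b⁻¹) - (b - a) = (b - a) ^ 2 / a := by field_simp
    have h3 : 0 ≤ (b - a) ^ 2 / a := by positivity
    linarith
  have h4 := mul_le_mul_of_nonneg_left h2 (Real.exp_pos b).le
  linarith

lemma barrierSlope_anti {x y : ℝ} (hx : 0 < x) (hxy : x ≤ y) :
    barrierSlope y ≤ barrierSlope x := by
  unfold barrierSlope
  have hy : 0 < y := hx.trans_le hxy
  gcongr

lemma barrierCurv_le {p x : ℝ} (hp : 0 < p) (hpx : p ≤ x) :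
    barrierCurv x ≤ (1 / p ^ 2 + 2 / p) * barrierSlope x := by
  unfold barrierCurv barrierSlope
  have hx : 0 < x := hp.trans_le hpx
  have h1 : x⁻¹ ≤ p⁻¹ := by gcongr
  have h2 : x⁻¹ ^ 2 + 2 * x⁻¹ ≤ 1 / p ^ 2 + 2 / p := by
    rw [one_div, ← inv_pow, div_eq_mul_inv]
    gcongr
  calc Real.exp x⁻¹ * (x⁻¹ ^ 4 + 2 * x⁻¹ ^ 3)
      = (x⁻¹ ^ 2 + 2 * x⁻¹) * (Real.exp x⁻¹ * x⁻¹ ^ 2) := by ring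
    _ ≤ _ := by gcongr

lemma barrierSlope_trapezoid_of_le {x y : ℝ} (hy : 0 < y) (hyx : y ≤ x) :
    barrierSlope y - barrierSlope x ≤ 1 / 2 * (barrierCurv x + barrierCurv y) * (x - y) := by
  unfold barrierSlope barrierCurv
  obtain ⟨b, hb, rfl⟩ : ∃ b : ℝ, 0 < b ∧ x = b⁻¹ :=
    ⟨x⁻¹, inv_pos.2 (hy.trans_le hyx), by simp⟩
  obtain ⟨a, ha, rfl⟩ : ∃ a : ℝ, 0 < a ∧ y = a⁻¹ := ⟨y⁻¹, by positivity, by simp⟩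
  simp only [inv_inv]
  have hba : b ≤ a := (inv_le_inv₀ ha hb).1 hyx
  obtain ⟨t, rfl⟩ : ∃ t, a = b + t := ⟨a - b, by ring⟩
  have ht : 0 ≤ t := by linarith
  have key : 0 ≤ Real.exp t * (t * (b + t) ^ 4 + 2 * t * (b + t) ^ 3 - 2 * (b + t) ^ 3 * b)
      + (t * b ^ 4 + 2 * t * b ^ 3 + 2 * (b + t) * b ^ 3) := by
    rcases le_total 0 (t * (b + t) ^ 4 + 2 * t * (b + t) ^ 3 - 2 * (b + t) ^ 3 * b) with h | h
    · positivity
    · have h2 : t < 2 := by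
        by_contra! h2
        have : 0 < t * (b + t) ^ 4 + 2 * t * (b + t) ^ 3 - 2 * (b + t) ^ 3 * b := by
          have : t * (b + t) ^ 4 + 2 * t * (b + t) ^ 3 - 2 * (b + t) ^ 3 * b
            = (b + t) ^ 3 * ((t - 2) * b + t ^ 2 + 2 * t) := by ring
          rw [this]
          have : 0 ≤ (t - 2) * b := mul_nonneg (by linarith) hb.le
          have : 0 < (t - 2) * b + t ^ 2 + 2 * t := by nlinarith
          positivity
        linarith
      have h3 := mul_le_mul_of_nonpos_right (two_sub_mul_exp_le ht) h
      have h4 : 0 ≤ (2 + t) * (t * (b + t) ^ 4 + 2 * t * (b + t) ^ 3 - 2 * (b + t) ^ 3 * b)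
          + (2 - t) * (t * b ^ 4 + 2 * t * b ^ 3 + 2 * (b + t) * b ^ 3) := by
        have : (2 + t) * (t * (b + t) ^ 4 + 2 * t * (b + t) ^ 3 - 2 * (b + t) ^ 3 * b)
          + (2 - t) * (t * b ^ 4 + 2 * t * b ^ 3 + 2 * (b + t) * b ^ 3)
          = 4 * t ^ 4 + 4 * t ^ 5 + t ^ 6 + 8 * b * t ^ 3 + 12 * b * t ^ 4 + 4 * b * t ^ 5
            + 12 * b ^ 2 * t ^ 3 + 6 * b ^ 2 * t ^ 4 + 4 * b ^ 3 * t ^ 3 := by ring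
        rw [this]
        positivity
      refine nonneg_of_mul_nonneg_right (a := 2 - t) ?_ (by linarith)
      linarith
  have e : Real.exp (b + t) = Real.exp b * Real.exp t := Real.exp_add b t
  rw [e, ← sub_nonneg]
  have : 1 / 2 * (Real.exp b * (b ^ 4 + 2 * b ^ 3)
        + Real.exp b * Real.exp t * ((b + t) ^ 4 + 2 * (b + t) ^ 3)) * (b⁻¹ - (b + t)⁻¹)
      - (Real.exp b * Real.exp t * (b + t) ^ 2 - Real.exp b * b ^ 2)
      = Real.exp b / (2 * b * (b + t)) *
        (Real.exp t * (t * (b + t) ^ 4 + 2 * t * (b + t) ^ 3 - 2 * (b + t) ^ 3 * b)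
        + (t * b ^ 4 + 2 * t * b ^ 3 + 2 * (b + t) * b ^ 3)) := by
    field_simp
    ring
  rw [this]
  positivity

lemma barrierSlope_trapezoid {x y : ℝ} (hx : 0 < x) (hy : 0 < y) :
    (barrierSlope y - barrierSlope x) * (x - y)
      ≤ 1 / 2 * (barrierCurv x + barrierCurv y) * (x - y) ^ 2 := by
  rcases le_total y x with h | h
  · have := mul_le_mul_of_nonneg_right (barrierSlope_trapezoid_of_le hy h) (sub_nonneg.2 h)
    linarith
  · have := mul_le_mul_of_nonneg_right (barrierSlope_trapezoid_of_le hx h) (sub_nonneg.2 h)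
    linarith

lemma barrierSlope_ratio {p x y : ℝ} (hp : 0 < p) (hpy : p ≤ y) (hyx : y ≤ x) :
    (1 - (1 / p ^ 2 + 2 / p) * (x - y) / 2) * barrierSlope y
      ≤ (1 + (1 / p ^ 2 + 2 / p) * (x - y) / 2) * barrierSlope x := by
  have h := barrierSlope_trapezoid_of_le (hp.trans_le hpy) hyx
  have h1 := mul_le_mul_of_nonneg_right (barrierCurv_le hp hpy) (sub_nonneg.2 hyx)
  have h2 := mul_le_mul_of_nonneg_right (barrierCurv_le hp (hpy.trans hyx)) (sub_nonneg.2 hyx)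
  linarith

lemma barrier_add_le {m x ε δ : ℝ} (hm : 0 < m) (hm2 : m ≤ 1 / 2) (hx : m ≤ x) (hε0 : 0 < ε)
    (hδ0 : 0 ≤ δ) (hδ : δ ≤ ε * m ^ 2) :
    barrier (x + δ) ≤ barrier x - (1 - 2 * ε) * δ * barrierSlope x := by
  have h1 := barrier_sub_le (hm.trans_le hx) (by linarith : 0 < x + δ)
  have h2 := barrierSlope_ratio hm hx (le_add_of_nonneg_right hδ0)
  rw [add_sub_cancel_left] at h2
  have h3 : (1 / m ^ 2 + 2 / m) * δ ≤ 2 * ε := by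
    calc (1 / m ^ 2 + 2 / m) * δ ≤ (1 / m ^ 2 + 2 / m) * (ε * m ^ 2) := by gcongr
      _ = ε * (1 + 2 * m) := by field_simp
      _ ≤ ε * 2 := by gcongr; linarith
      _ = 2 * ε := by ring
  have h4 := barrierSlope_nonneg x
  have h5 := barrierSlope_nonneg (x + δ)
  have h6 : (1 - 2 * ε) * barrierSlope x ≤ barrierSlope (x + δ) := by
    have : (1 - ε) * barrierSlope x ≤ (1 + ε) * barrierSlope (x + δ) := by
      nlinarith
    refine le_of_mul_le_mul_left ?_ (by linarith : 0 < 1 + ε)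
    nlinarith [mul_nonneg (sq_nonneg ε) h4]
  nlinarith [mul_le_mul_of_nonneg_right h6 hδ0]

lemma curvature_bound {m ε : ℝ} (hm : 0 < m) (hm2 : m ≤ 1 / 2) (hε0 : 0 ≤ ε) :
    (1 / (19 / 20 * m) ^ 2 + 2 / (19 / 20 * m)) * (ε * m ^ 2) ≤ 11 / 5 * ε := by
  have : (1 / (19 / 20 * m) ^ 2 + 2 / (19 / 20 * m)) * (ε * m ^ 2)
      = ε * (400 / 361 + 40 / 19 * m) := by
    field_simp
    ring
  rw [this]
  nlinarith

lemma barrier_sub_shift_le {m x ε δ : ℝ} (hm : 0 < m) (hm2 : m ≤ 1 / 2) (hε0 : 0 < ε)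
    (hε : ε ≤ 1 / 10) (hx : m ≤ x) (hδ0 : 0 ≤ δ) (hδ : δ ≤ ε * m ^ 2 / 2) :
    barrier (x - δ) ≤ barrier x + (1 + 2 * ε) * δ * barrierSlope x := by
  have hδm : δ ≤ m / 20 := by nlinarith
  have hp : 19 / 20 * m ≤ x - δ := by linarith
  have h1 := barrier_sub_le (hm.trans_le hx) (by linarith : 0 < x - δ)
  have h2 := barrierSlope_ratio (by positivity : 0 < 19 / 20 * m) hp (sub_le_self x hδ0)
  rw [sub_sub_cancel] at h1 h2
  have h3 : (1 / (19 / 20 * m) ^ 2 + 2 / (19 / 20 * m)) * δ ≤ 11 / 10 * ε := by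
    calc _ ≤ (1 / (19 / 20 * m) ^ 2 + 2 / (19 / 20 * m)) * (ε * m ^ 2 / 2) := by gcongr
      _ ≤ _ := by linarith [curvature_bound hm hm2 hε0.le]
  have h4 := barrierSlope_nonneg x
  have h5 := barrierSlope_nonneg (x - δ)
  have h6 : barrierSlope (x - δ) ≤ (1 + 2 * ε) * barrierSlope x := by
    have : (1 - 11 / 20 * ε) * barrierSlope (x - δ) ≤ (1 + 11 / 20 * ε) * barrierSlope x := by
      nlinarith
    refine le_of_mul_le_mul_left (this.trans ?_) (by linarith : 0 < 1 - 11 / 20 * ε)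
    rw [← mul_assoc]
    exact mul_le_mul_of_nonneg_right (by nlinarith) h4
  nlinarith [mul_le_mul_of_nonneg_right h6 hδ0]

/-- The matrix with eigenvalues `d` in the basis given by the columns of `U`. -/
def conjDiag {ι : Type*} [Fintype ι] [DecidableEq ι] (U : Matrix ι ι ℝ) (d : ι → ℝ) :
    Matrix ι ι ℝ :=
  U * diagonal d * Uᴴ

lemma conjTranspose_mul_mul_apply_swap {ι : Type*} [Fintype ι] {D : Matrix ι ι ℝ}
    (U V : Matrix ι ι ℝ) (hD : D.IsHermitian) (i j : ι) :
    (Vᴴ * D * U) j i = (Uᴴ * D * V) i j := by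
  have : (Vᴴ * D * U)ᴴ = Uᴴ * D * V := by
    simp only [Matrix.conjTranspose_mul, conjTranspose_conjTranspose, hD.eq, Matrix.mul_assoc]
  rw [← this, conjTranspose_apply, star_trivial]

section Spectral

variable {ι : Type*} [Fintype ι] [DecidableEq ι] {U V X D : Matrix ι ι ℝ}

lemma exists_eq_conjDiag (hX : X.IsHermitian) :
    ∃ (U : Matrix ι ι ℝ) (d : ι → ℝ), Uᴴ * U = 1 ∧ X = conjDiag U d := by
  refine ⟨hX.eigenvectorUnitary, hX.eigenvalues, ?_, ?_⟩
  · exact Unitary.coe_star_mul_self hX.eigenvectorUnitary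
  · conv_lhs => rw [hX.spectral_theorem, Unitary.conjStarAlgAut_apply]
    rfl

lemma conjDiag_mul (hU : Uᴴ * U = 1) (a b : ι → ℝ) :
    conjDiag U a * conjDiag U b = conjDiag U (fun i => a i * b i) := by
  calc conjDiag U a * conjDiag U b
      = U * diagonal a * (Uᴴ * U) * diagonal b * Uᴴ := by simp only [conjDiag, Matrix.mul_assoc]
    _ = conjDiag U (fun i => a i * b i) := by
      rw [hU, Matrix.mul_one, Matrix.mul_assoc U, diagonal_mul_diagonal, conjDiag]

lemma conjDiag_const (hU : Uᴴ * U = 1) (c : ℝ) :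
    conjDiag U (fun _ => c) = c • (1 : Matrix ι ι ℝ) := by
  have : diagonal (fun _ : ι => c) = c • (1 : Matrix ι ι ℝ) := by
    rw [smul_one_eq_diagonal]
  rw [conjDiag, this, Matrix.mul_smul, Matrix.mul_one, Matrix.smul_mul, mul_eq_one_comm.1 hU]

lemma conjDiag_add (U : Matrix ι ι ℝ) (a b : ι → ℝ) :
    conjDiag U a + conjDiag U b = conjDiag U (fun i => a i + b i) := by
  rw [conjDiag, conjDiag, conjDiag, ← diagonal_add, Matrix.mul_add, Matrix.add_mul]

lemma conjDiag_add_smul_one (hU : Uᴴ * U = 1) (d : ι → ℝ) (c : ℝ) :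
    conjDiag U d + c • (1 : Matrix ι ι ℝ) = conjDiag U (fun i => d i + c) := by
  rw [← conjDiag_const hU, conjDiag_add]

lemma conjDiag_sub_smul_one (hU : Uᴴ * U = 1) (d : ι → ℝ) (c : ℝ) :
    conjDiag U d - c • (1 : Matrix ι ι ℝ) = conjDiag U (fun i => d i - c) := by
  simpa [sub_eq_add_neg] using conjDiag_add_smul_one hU d (-c)

lemma conjTranspose_mul_conjDiag_mul (hU : Uᴴ * U = 1) (d : ι → ℝ) :
    Uᴴ * conjDiag U d * U = diagonal d := by
  calc Uᴴ * conjDiag U d * U = (Uᴴ * U) * diagonal d * (Uᴴ * U) := by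
        simp only [conjDiag, Matrix.mul_assoc]
    _ = diagonal d := by rw [hU, Matrix.one_mul, Matrix.mul_one]

lemma posSemidef_conjDiag_iff (hU : Uᴴ * U = 1) {d : ι → ℝ} :
    (conjDiag U d).PosSemidef ↔ ∀ i, 0 ≤ d i := by
  refine ⟨fun h => ?_, fun h => ?_⟩
  · have := h.conjTranspose_mul_mul_same U
    rw [conjTranspose_mul_conjDiag_mul hU] at this
    exact posSemidef_diagonal_iff.1 this
  · exact (PosSemidef.diagonal (d := d) h).mul_mul_conjTranspose_same U

lemma pos_of_posDef_conjDiag (hU : Uᴴ * U = 1) {d : ι → ℝ} (h : (conjDiag U d).PosDef) (i : ι) :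
    0 < d i := by
  have hinj : Function.Injective U.mulVec := Matrix.mulVec_injective_of_isUnit
    (IsUnit.of_mul_eq_one_right _ hU)
  have := h.conjTranspose_mul_mul_same hinj
  rw [conjTranspose_mul_conjDiag_mul hU] at this
  exact posDef_diagonal_iff.1 this i

lemma inv_conjDiag (hU : Uᴴ * U = 1) {d : ι → ℝ} (hd : ∀ i, d i ≠ 0) :
    (conjDiag U d)⁻¹ = conjDiag U (fun i => (d i)⁻¹) := by
  refine Matrix.inv_eq_right_inv ?_
  rw [conjDiag_mul hU]
  simp only [mul_inv_cancel₀ (hd _)]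
  simpa using conjDiag_const hU 1

lemma exp_conjDiag (hU : Uᴴ * U = 1) (d : ι → ℝ) :
    NormedSpace.exp (conjDiag U d) = conjDiag U (fun i => Real.exp (d i)) := by
  have h : U⁻¹ = Uᴴ := Matrix.inv_eq_left_inv hU
  rw [conjDiag, ← h, Matrix.exp_conj _ _ (IsUnit.of_mul_eq_one_right _ hU), Matrix.exp_diagonal, h,
    conjDiag]
  congr
  ext i
  simp [Pi.coe_exp, Real.exp_eq_exp_ℝ]

lemma trace_conjDiag (hU : Uᴴ * U = 1) (d : ι → ℝ) : (conjDiag U d).trace = ∑ i, d i := by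
  rw [conjDiag, Matrix.trace_mul_comm, ← Matrix.mul_assoc, hU, Matrix.one_mul, trace_diagonal]

lemma trace_conjDiag_mul (U D : Matrix ι ι ℝ) (a : ι → ℝ) :
    (conjDiag U a * D).trace = ∑ i, a i * (Uᴴ * D * U) i i := by
  have : (conjDiag U a * D).trace = (diagonal a * (Uᴴ * D * U)).trace := by
    rw [conjDiag, Matrix.mul_assoc, Matrix.mul_assoc, Matrix.trace_mul_comm]
    simp only [Matrix.mul_assoc]
  rw [this, Matrix.trace]
  simp [diagonal_mul]

lemma trace_conjDiag_mul_mono {a b : ι → ℝ} (U : Matrix ι ι ℝ) (hab : ∀ i, a i ≤ b i)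
    (hD : D.PosSemidef) : (conjDiag U a * D).trace ≤ (conjDiag U b * D).trace := by
  rw [trace_conjDiag_mul, trace_conjDiag_mul]
  gcongr with i
  · exact (hD.conjTranspose_mul_mul_same U).diag_nonneg
  · exact hab i

lemma trace_conjDiag_mul_conjDiag_mul (U V B C : Matrix ι ι ℝ) (a b : ι → ℝ) :
    (conjDiag U a * B * conjDiag V b * C).trace
      = ∑ i, ∑ j, a i * b j * ((Uᴴ * B * V) i j * (Vᴴ * C * U) j i) := by
  have : (conjDiag U a * B * conjDiag V b * C).trace
      = ((diagonal a * (Uᴴ * B * V)) * (diagonal b * (Vᴴ * C * U))).trace := by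
    rw [conjDiag, conjDiag, Matrix.mul_assoc, Matrix.mul_assoc, Matrix.mul_assoc, Matrix.mul_assoc,
      Matrix.trace_mul_comm]
    simp only [Matrix.mul_assoc]
  rw [this, Matrix.trace]
  simp only [diag_apply, Matrix.mul_apply (M := diagonal a * _), diagonal_mul]
  exact Finset.sum_congr rfl fun i _ => Finset.sum_congr rfl fun j _ => by ring

lemma conjTranspose_mul_sub_mul (hU : Uᴴ * U = 1) (hV : Vᴴ * V = 1) (x y : ι → ℝ) (i j : ι) :
    (Uᴴ * (conjDiag U x - conjDiag V y) * V) i j = (x i - y j) * (Uᴴ * V) i j := by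
  have : Uᴴ * (conjDiag U x - conjDiag V y) * V
      = diagonal x * (Uᴴ * V) - (Uᴴ * V) * diagonal y := by
    calc _ = (Uᴴ * U) * diagonal x * (Uᴴ * V) - (Uᴴ * V) * diagonal y * (Vᴴ * V) := by
          simp only [conjDiag, Matrix.mul_assoc, Matrix.mul_sub, Matrix.sub_mul]
      _ = _ := by rw [hU, hV, Matrix.one_mul, Matrix.mul_one]
  rw [this, Matrix.sub_apply, diagonal_mul, mul_diagonal]
  ring

lemma isHermitian_conjDiag (U : Matrix ι ι ℝ) (d : ι → ℝ) : (conjDiag U d).IsHermitian :=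
  isHermitian_mul_mul_conjTranspose U (isHermitian_diagonal d)

lemma sum_eq_sum_sum_left (hU : Uᴴ * U = 1) (hV : Vᴴ * V = 1) (a : ι → ℝ) :
    ∑ i, a i = ∑ i, ∑ j, a i * (Uᴴ * V) i j ^ 2 := by
  have h := trace_conjDiag_mul_conjDiag_mul U V 1 1 a (fun _ => 1)
  rw [conjDiag_const hV, one_smul, Matrix.mul_one, Matrix.mul_one, Matrix.mul_one,
    trace_conjDiag hU] at h
  simp only [conjTranspose_mul_mul_apply_swap U V isHermitian_one] at h
  rw [h, Matrix.mul_one]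
  simp [sq]

lemma sum_eq_sum_sum_right (hU : Uᴴ * U = 1) (hV : Vᴴ * V = 1) (b : ι → ℝ) :
    ∑ j, b j = ∑ i, ∑ j, b j * (Uᴴ * V) i j ^ 2 := by
  rw [sum_eq_sum_sum_left hV hU, Finset.sum_comm]
  have h := conjTranspose_mul_mul_apply_swap U V isHermitian_one
  simp only [Matrix.mul_one] at h
  simp only [h]

lemma trace_conjDiag_mul_sub_left (hU : Uᴴ * U = 1) (hV : Vᴴ * V = 1) (x y a : ι → ℝ) :
    (conjDiag U a * (conjDiag U x - conjDiag V y)).trace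
      = ∑ i, ∑ j, a i * (x i - y j) * (Uᴴ * V) i j ^ 2 := by
  have h := trace_conjDiag_mul_conjDiag_mul U V (conjDiag U x - conjDiag V y) 1 a (fun _ => 1)
  rw [conjDiag_const hV, one_smul, Matrix.mul_one, Matrix.mul_one] at h
  simp only [conjTranspose_mul_mul_apply_swap U V isHermitian_one,
    conjTranspose_mul_sub_mul hU hV] at h
  rw [h, Matrix.mul_one]
  exact Finset.sum_congr rfl fun i _ => Finset.sum_congr rfl fun j _ => by ring

lemma trace_conjDiag_mul_sub_right (hU : Uᴴ * U = 1) (hV : Vᴴ * V = 1) (x y b : ι → ℝ) :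
    (conjDiag V b * (conjDiag U x - conjDiag V y)).trace
      = ∑ i, ∑ j, b j * (x i - y j) * (Uᴴ * V) i j ^ 2 := by
  have h := trace_conjDiag_mul_sub_left hV hU y x b
  rw [← neg_sub (conjDiag U x), Matrix.mul_neg, trace_neg, neg_eq_iff_eq_neg] at h
  have hs := conjTranspose_mul_mul_apply_swap U V isHermitian_one
  simp only [Matrix.mul_one] at hs
  rw [h, Finset.sum_comm, ← Finset.sum_neg_distrib]
  refine Finset.sum_congr rfl fun i _ => ?_
  rw [← Finset.sum_neg_distrib]
  refine Finset.sum_congr rfl fun j _ => ?_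
  rw [hs]
  ring

lemma trace_conjDiag_mul_sub_mul_sub_left (hU : Uᴴ * U = 1) (hV : Vᴴ * V = 1) (x y a : ι → ℝ) :
    (conjDiag U a * ((conjDiag U x - conjDiag V y) * (conjDiag U x - conjDiag V y))).trace
      = ∑ i, ∑ j, a i * (x i - y j) ^ 2 * (Uᴴ * V) i j ^ 2 := by
  have h := trace_conjDiag_mul_conjDiag_mul U V (conjDiag U x - conjDiag V y)
    (conjDiag U x - conjDiag V y) a (fun _ => 1)
  have hD := (isHermitian_conjDiag U x).sub (isHermitian_conjDiag V y)
  rw [conjDiag_const hV, one_smul, Matrix.mul_one, Matrix.mul_assoc] at h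
  simp only [conjTranspose_mul_mul_apply_swap U V hD, conjTranspose_mul_sub_mul hU hV] at h
  rw [h]
  exact Finset.sum_congr rfl fun i _ => Finset.sum_congr rfl fun j _ => by ring

lemma trace_conjDiag_mul_sub_mul_sub_right (hU : Uᴴ * U = 1) (hV : Vᴴ * V = 1) (x y b : ι → ℝ) :
    (conjDiag V b * ((conjDiag U x - conjDiag V y) * (conjDiag U x - conjDiag V y))).trace
      = ∑ i, ∑ j, b j * (x i - y j) ^ 2 * (Uᴴ * V) i j ^ 2 := by
  have h := trace_conjDiag_mul_sub_mul_sub_left hV hU y x b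
  rw [← neg_sub (conjDiag U x), neg_mul_neg] at h
  have hs := conjTranspose_mul_mul_apply_swap U V isHermitian_one
  simp only [Matrix.mul_one] at hs
  rw [h, Finset.sum_comm]
  refine Finset.sum_congr rfl fun i _ => Finset.sum_congr rfl fun j _ => ?_
  rw [hs]
  ring

/-- A Klein-type inequality for the trace of the barrier function. -/
lemma sum_barrier_sub_le (hU : Uᴴ * U = 1) (hV : Vᴴ * V = 1) {x y : ι → ℝ}
    (hx : ∀ i, 0 < x i) (hy : ∀ i, 0 < y i) :
    ∑ i, barrier (y i) - ∑ i, barrier (x i)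
      ≤ (conjDiag V (fun i => barrierSlope (y i)) * (conjDiag U x - conjDiag V y)).trace := by
  rw [trace_conjDiag_mul_sub_right hU hV, sum_eq_sum_sum_right hU hV (fun i => barrier (y i)),
    sum_eq_sum_sum_left hU hV (fun i => barrier (x i)), ← Finset.sum_sub_distrib]
  refine Finset.sum_le_sum fun i _ => ?_
  rw [← Finset.sum_sub_distrib]
  refine Finset.sum_le_sum fun j _ => ?_
  rw [← sub_mul]
  exact mul_le_mul_of_nonneg_right (barrier_sub_le (hx i) (hy j)) (sq_nonneg _)

/-- A trapezoidal-rule bound for the change of the gradient of the trace of the barrier function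
along the direction of motion. -/
lemma trace_barrierSlope_trapezoid (hU : Uᴴ * U = 1) (hV : Vᴴ * V = 1) {x y : ι → ℝ}
    (hx : ∀ i, 0 < x i) (hy : ∀ i, 0 < y i) (hD : D = conjDiag U x - conjDiag V y) :
    (conjDiag V (fun i => barrierSlope (y i)) * D).trace
        - (conjDiag U (fun i => barrierSlope (x i)) * D).trace
      ≤ 1 / 2 * ((conjDiag U (fun i => barrierCurv (x i)) * (D * D)).trace
        + (conjDiag V (fun i => barrierCurv (y i)) * (D * D)).trace) := by
  subst hD
  rw [trace_conjDiag_mul_sub_right hU hV, trace_conjDiag_mul_sub_left hU hV,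
    trace_conjDiag_mul_sub_mul_sub_right hU hV, trace_conjDiag_mul_sub_mul_sub_left hU hV,
    ← Finset.sum_sub_distrib, ← Finset.sum_add_distrib, Finset.mul_sum]
  refine Finset.sum_le_sum fun i _ => ?_
  rw [← Finset.sum_sub_distrib, ← Finset.sum_add_distrib, Finset.mul_sum]
  refine Finset.sum_le_sum fun j _ => ?_
  have := mul_le_mul_of_nonneg_right (barrierSlope_trapezoid (hx i) (hy j))
    (sq_nonneg ((Uᴴ * V) i j))
  linarith

lemma posSemidef_smul_sub_mul_self {d : ℝ} (hd : 0 < d) (hD : D.PosSemidef)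
    (hDd : (d • (1 : Matrix ι ι ℝ) - D).PosSemidef) : (d • D - D * D).PosSemidef := by
  have h1 := hDd.conjTranspose_mul_mul_same D
  have h2 := hD.conjTranspose_mul_mul_same (d • (1 : Matrix ι ι ℝ) - D)
  rw [hD.isHermitian.eq] at h1
  rw [hDd.isHermitian.eq] at h2
  have h3 : d • D - D * D = d⁻¹ • (D * (d • (1 : Matrix ι ι ℝ) - D) * D
      + (d • (1 : Matrix ι ι ℝ) - D) * D * (d • (1 : Matrix ι ι ℝ) - D)) := by
    rw [eq_inv_smul_iff₀ hd.ne']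
    simp only [Matrix.mul_sub, Matrix.sub_mul, Matrix.mul_smul, Matrix.smul_mul, Matrix.mul_one,
      Matrix.one_mul, smul_sub]
    abel
  rw [h3]
  exact (h1.add h2).smul (inv_nonneg.2 hd.le)

lemma trace_barrierCurv_le {d p : ℝ} (hd : 0 < d) (hp : 0 < p) (hD : D.PosSemidef)
    (hDd : (d • (1 : Matrix ι ι ℝ) - D).PosSemidef) (U : Matrix ι ι ℝ) {x : ι → ℝ}
    (hx : ∀ i, p ≤ x i) :
    (conjDiag U (fun i => barrierCurv (x i)) * (D * D)).trace
      ≤ (1 / p ^ 2 + 2 / p) * d * (conjDiag U (fun i => barrierSlope (x i)) * D).trace := by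
  rw [trace_conjDiag_mul, trace_conjDiag_mul, Finset.mul_sum]
  refine Finset.sum_le_sum fun i _ => ?_
  have h1 : 0 ≤ (Uᴴ * D * U) i i := (hD.conjTranspose_mul_mul_same U).diag_nonneg
  have h2 : 0 ≤ (Uᴴ * (d • D - D * D) * U) i i :=
    ((posSemidef_smul_sub_mul_self hd hD hDd).conjTranspose_mul_mul_same U).diag_nonneg
  rw [Matrix.mul_sub, Matrix.sub_mul, Matrix.mul_smul, Matrix.smul_mul, Matrix.sub_apply,
    Matrix.smul_apply, smul_eq_mul, sub_nonneg] at h2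
  have hxi : 0 < x i := hp.trans_le (hx i)
  have h3 : 0 ≤ barrierCurv (x i) := by unfold barrierCurv; positivity
  calc barrierCurv (x i) * (Uᴴ * (D * D) * U) i i
      ≤ barrierCurv (x i) * (d * (Uᴴ * D * U) i i) := mul_le_mul_of_nonneg_left h2 h3
    _ ≤ ((1 / p ^ 2 + 2 / p) * barrierSlope (x i)) * (d * (Uᴴ * D * U) i i) :=
      mul_le_mul_of_nonneg_right (barrierCurv_le hp (hx i)) (mul_nonneg hd.le h1)
    _ = _ := by ring

/-- The trace of the barrier function applied to a symmetric matrix. -/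
noncomputable def barrierTrace (X : Matrix ι ι ℝ) : ℝ := (NormedSpace.exp X⁻¹).trace

/-- The negated gradient of `barrierTrace`. -/
noncomputable def barrierGrad (X : Matrix ι ι ℝ) : Matrix ι ι ℝ := NormedSpace.exp X⁻¹ * X⁻¹ ^ 2

lemma barrierTrace_conjDiag (hU : Uᴴ * U = 1) {x : ι → ℝ} (hx : ∀ i, 0 < x i) :
    barrierTrace (conjDiag U x) = ∑ i, barrier (x i) := by
  rw [barrierTrace, inv_conjDiag hU fun i => (hx i).ne', exp_conjDiag hU, trace_conjDiag hU]
  rfl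

lemma barrierGrad_conjDiag (hU : Uᴴ * U = 1) {x : ι → ℝ} (hx : ∀ i, 0 < x i) :
    barrierGrad (conjDiag U x) = conjDiag U (fun i => barrierSlope (x i)) := by
  rw [barrierGrad, inv_conjDiag hU fun i => (hx i).ne', exp_conjDiag hU, pow_two,
    conjDiag_mul hU, conjDiag_mul hU]
  simp only [barrierSlope, pow_two]

/-- A matrix bounded below by `p • 1` diagonalizes with all eigenvalues at least `p`. -/
lemma exists_eq_conjDiag_of_le {p : ℝ} (hX : (X - p • (1 : Matrix ι ι ℝ)).PosSemidef) :
    ∃ (U : Matrix ι ι ℝ) (x : ι → ℝ), Uᴴ * U = 1 ∧ X = conjDiag U x ∧ ∀ i, p ≤ x i := by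
  obtain ⟨U, d, hU, hd⟩ := exists_eq_conjDiag hX.isHermitian
  refine ⟨U, fun i => d i + p, hU, ?_, fun i => ?_⟩
  · rw [← conjDiag_add_smul_one hU, ← hd, sub_add_cancel]
  · rw [hd, posSemidef_conjDiag_iff hU] at hX
    linarith [hX i]

lemma trace_barrierGrad_mul_nonneg {p : ℝ} (hp : 0 < p)
    (hX : (X - p • (1 : Matrix ι ι ℝ)).PosSemidef) (hD : D.PosSemidef) :
    0 ≤ (barrierGrad X * D).trace := by
  obtain ⟨U, x, hU, rfl, hx⟩ := exists_eq_conjDiag_of_le hX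
  rw [barrierGrad_conjDiag hU fun i => hp.trans_le (hx i)]
  have := trace_conjDiag_mul_mono (a := fun _ => 0) U (fun i => barrierSlope_nonneg (x i)) hD
  rwa [conjDiag_const hU, zero_smul, Matrix.zero_mul, trace_zero] at this

lemma barrier_step {Y : Matrix ι ι ℝ} {p d : ℝ} (hp : 0 < p) (hd : 0 < d)
    (hX : (X - p • (1 : Matrix ι ι ℝ)).PosSemidef) (hY : (Y - p • (1 : Matrix ι ι ℝ)).PosSemidef)
    (hXY : D = X - Y) (hD : D.PosSemidef) (hDd : (d • (1 : Matrix ι ι ℝ) - D).PosSemidef) :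
    barrierTrace Y - barrierTrace X ≤ (barrierGrad Y * D).trace ∧
    barrierTrace X - barrierTrace Y ≤ -(barrierGrad X * D).trace ∧
    (1 - (1 / p ^ 2 + 2 / p) * d / 2) * (barrierGrad Y * D).trace
      ≤ (1 + (1 / p ^ 2 + 2 / p) * d / 2) * (barrierGrad X * D).trace := by
  obtain ⟨U, x, hU, rfl, hx⟩ := exists_eq_conjDiag_of_le hX
  obtain ⟨V, y, hV, rfl, hy⟩ := exists_eq_conjDiag_of_le hY
  have hx0 : ∀ i, 0 < x i := fun i => hp.trans_le (hx i)
  have hy0 : ∀ i, 0 < y i := fun i => hp.trans_le (hy i)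
  rw [barrierTrace_conjDiag hU hx0, barrierTrace_conjDiag hV hy0, barrierGrad_conjDiag hU hx0,
    barrierGrad_conjDiag hV hy0]
  refine ⟨?_, ?_, ?_⟩
  · rw [hXY]
    exact sum_barrier_sub_le hU hV hx0 hy0
  · rw [hXY, ← trace_neg, ← Matrix.mul_neg, neg_sub]
    exact sum_barrier_sub_le hV hU hy0 hx0
  · have h1 := trace_barrierSlope_trapezoid hU hV hx0 hy0 hXY
    have h2 := trace_barrierCurv_le hd hp hD hDd U hx
    have h3 := trace_barrierCurv_le hd hp hD hDd V hy
    linarith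

lemma sub_smul_one_mono {s t : ℝ} (hst : s ≤ t)
    (hX : (X - t • (1 : Matrix ι ι ℝ)).PosSemidef) :
    (X - s • (1 : Matrix ι ι ℝ)).PosSemidef := by
  have h : X - s • (1 : Matrix ι ι ℝ) = X - t • (1 : Matrix ι ι ℝ) + (t - s) • 1 := by
    rw [sub_smul]; abel
  rw [h]
  exact hX.add (PosSemidef.one.smul (sub_nonneg.2 hst))

lemma barrierTrace_perturb {m ε d : ℝ} (hm : 0 < m) (hm2 : m ≤ 1 / 2) (hε0 : 0 < ε)
    (hε : ε ≤ 1 / 10) (hd0 : 0 < d) (hd : d ≤ ε * m ^ 2)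
    (hX : (X - D - (19 / 20 * m) • (1 : Matrix ι ι ℝ)).PosSemidef) (hD : D.PosSemidef)
    (hDd : (d • (1 : Matrix ι ι ℝ) - D).PosSemidef) :
    barrierTrace (X - D) ≤ barrierTrace X + (1 + 2 * ε) * (barrierGrad X * D).trace ∧
    barrierTrace X ≤ barrierTrace (X - D)
      - (1 - 2 * ε) * (barrierGrad (X - D) * D).trace := by
  have hp : 0 < 19 / 20 * m := by positivity
  have hD' : ((1 / 2 : ℝ) • D).PosSemidef := hD.smul (by norm_num)
  have hDd' : ((d / 2) • (1 : Matrix ι ι ℝ) - (1 / 2 : ℝ) • D).PosSemidef := by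
    have h : (d / 2) • (1 : Matrix ι ι ℝ) - (1 / 2 : ℝ) • D
        = (1 / 2 : ℝ) • (d • (1 : Matrix ι ι ℝ) - D) := by
      rw [smul_sub, smul_smul]; ring_nf
    rw [h]
    exact hDd.smul (by norm_num)
  have hhalf : (1 / 2 : ℝ) • D + (1 / 2 : ℝ) • D = D := by
    rw [← add_smul]; norm_num
  have e1 : X - (1 / 2 : ℝ) • D = X - D + (1 / 2 : ℝ) • D := by
    nth_rewrite 2 [← hhalf]; abel
  have hX1 : (X - (1 / 2 : ℝ) • D - (19 / 20 * m) • (1 : Matrix ι ι ℝ)).PosSemidef := by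
    rw [e1, add_sub_right_comm]
    exact hX.add hD'
  have hX0 : (X - (19 / 20 * m) • (1 : Matrix ι ι ℝ)).PosSemidef := by
    have h := hX1.add hD'
    rwa [← add_sub_right_comm, sub_add_cancel] at h
  obtain ⟨a1, a2, a3⟩ := barrier_step hp (half_pos hd0) hX0 hX1 (sub_sub_cancel _ _).symm hD' hDd'
  obtain ⟨b1, b2, b3⟩ := barrier_step hp (half_pos hd0) hX1 hX
    (by rw [e1, add_sub_cancel_left]) hD' hDd'
  have g0 := trace_barrierGrad_mul_nonneg hp hX0 hD
  have g1 := trace_barrierGrad_mul_nonneg hp hX1 hD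
  have g2 := trace_barrierGrad_mul_nonneg hp hX hD
  simp only [Matrix.mul_smul, trace_smul, smul_eq_mul] at a1 a2 a3 b1 b2 b3
  have hk : (1 / (19 / 20 * m) ^ 2 + 2 / (19 / 20 * m)) * (d / 2) / 2 ≤ 11 / 20 * ε := by
    calc _ ≤ (1 / (19 / 20 * m) ^ 2 + 2 / (19 / 20 * m)) * (ε * m ^ 2 / 2) / 2 := by gcongr
      _ ≤ _ := by linarith [curvature_bound hm hm2 hε0.le]
  set q := (1 / (19 / 20 * m) ^ 2 + 2 / (19 / 20 * m)) * (d / 2) / 2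
  set G0 := (barrierGrad X * D).trace
  set G1 := (barrierGrad (X - (1 / 2 : ℝ) • D) * D).trace
  set G2 := (barrierGrad (X - D) * D).trace
  have key : ∀ G H : ℝ, 0 ≤ G → 0 ≤ H → (1 - q) * (1 / 2 * H) ≤ (1 + q) * (1 / 2 * G) →
      H ≤ (1 + 117 / 100 * ε) * G ∧ (1 - 117 / 100 * ε) * H ≤ G := by
    intro G H hG hH h
    have h1 : (1 - 11 / 20 * ε) * H ≤ (1 + 11 / 20 * ε) * G := by nlinarith
    constructor
    · refine le_of_mul_le_mul_left (h1.trans ?_) (by linarith : 0 < 1 - 11 / 20 * ε)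
      rw [← mul_assoc]
      exact mul_le_mul_of_nonneg_right (by nlinarith) hG
    · refine le_of_mul_le_mul_left (le_trans ?_ h1) (by linarith : 0 < 1 + 11 / 20 * ε)
      rw [← mul_assoc]
      exact mul_le_mul_of_nonneg_right (by nlinarith) hH
  obtain ⟨k1, k2⟩ := key G0 G1 g0 g1 a3
  obtain ⟨k3, k4⟩ := key G1 G2 g1 g2 b3
  constructor
  · have h2 : G2 ≤ (1 + 117 / 100 * ε) * ((1 + 117 / 100 * ε) * G0) :=
      k3.trans (mul_le_mul_of_nonneg_left k1 (by linarith))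
    nlinarith [mul_nonneg (mul_nonneg hε0.le g0) (sub_nonneg.2 hε), mul_nonneg hε0.le g0]
  · have h2 : (1 - 117 / 100 * ε) * ((1 - 117 / 100 * ε) * G2) ≤ G0 :=
      (mul_le_mul_of_nonneg_left k4 (by linarith)).trans k2
    nlinarith [mul_nonneg (mul_nonneg hε0.le g2) hε0.le, mul_nonneg hε0.le g2]

/-- Change of the potential when the matrix decreases by `D` and the barrier recedes by `δ`. -/
lemma barrierTrace_add_sub_le {m ε d δ : ℝ} (hm : 0 < m) (hm2 : m ≤ 1 / 2) (hε0 : 0 < ε)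
    (hε : ε ≤ 1 / 10) (hd0 : 0 < d) (hd : d ≤ ε * m ^ 2) (hδ0 : 0 ≤ δ) (hδ : δ ≤ d)
    (hX : (X - m • (1 : Matrix ι ι ℝ)).PosSemidef) (hD : D.PosSemidef)
    (hDd : (d • (1 : Matrix ι ι ℝ) - D).PosSemidef) :
    barrierTrace (X + δ • (1 : Matrix ι ι ℝ) - D) ≤ barrierTrace X
      + (1 + 2 * ε) * (barrierGrad X * D).trace - (1 - 2 * ε) * δ * (barrierGrad X).trace := by
  have hdm : d ≤ m / 20 := by nlinarith
  have hX2 : (X + δ • (1 : Matrix ι ι ℝ) - D - (19 / 20 * m) • (1 : Matrix ι ι ℝ)).PosSemidef := by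
    have h : X + δ • (1 : Matrix ι ι ℝ) - D - (19 / 20 * m) • (1 : Matrix ι ι ℝ)
        = X - m • (1 : Matrix ι ι ℝ) + (d • (1 : Matrix ι ι ℝ) - D)
          + (m / 20 - d + δ) • (1 : Matrix ι ι ℝ) := by module
    rw [h]
    exact (hX.add hDd).add (PosSemidef.one.smul (by linarith))
  refine (barrierTrace_perturb hm hm2 hε0 hε hd0 hd hX2 hD hDd).1.trans ?_
  obtain ⟨U, x, hU, rfl, hx⟩ := exists_eq_conjDiag_of_le hX
  have hx0 : ∀ i, 0 < x i := fun i => hm.trans_le (hx i)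
  have hx1 : ∀ i, 0 < x i + δ := fun i => add_pos_of_pos_of_nonneg (hx0 i) hδ0
  rw [conjDiag_add_smul_one hU, barrierTrace_conjDiag hU hx0, barrierTrace_conjDiag hU hx1,
    barrierGrad_conjDiag hU hx0, barrierGrad_conjDiag hU hx1, trace_conjDiag hU]
  have h1 := trace_conjDiag_mul_mono U
    (fun i => barrierSlope_anti (hx0 i) (le_add_of_nonneg_right hδ0 : x i ≤ x i + δ)) hD
  have h2 : ∑ i, barrier (x i + δ)
      ≤ ∑ i, (barrier (x i) - (1 - 2 * ε) * δ * barrierSlope (x i)) :=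
    Finset.sum_le_sum fun i _ => barrier_add_le hm hm2 (hx i) hε0 hδ0 (hδ.trans hd)
  rw [Finset.sum_sub_distrib, ← Finset.mul_sum] at h2
  have h3 := mul_le_mul_of_nonneg_left h1 (by linarith : 0 ≤ 1 + 2 * ε)
  linarith

/-- Change of the potential when the matrix increases by `D` and the barrier advances by `δ`. -/
lemma barrierTrace_sub_add_le {m ε d δ : ℝ} (hm : 0 < m) (hm2 : m ≤ 1 / 2) (hε0 : 0 < ε)
    (hε : ε ≤ 1 / 10) (hd0 : 0 < d) (hd : d ≤ ε * m ^ 2) (hδ0 : 0 ≤ δ) (hδ : δ ≤ d / 2)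
    (hX : (X - m • (1 : Matrix ι ι ℝ)).PosSemidef) (hD : D.PosSemidef)
    (hDd : (d • (1 : Matrix ι ι ℝ) - D).PosSemidef) :
    barrierTrace (X - δ • (1 : Matrix ι ι ℝ) + D) ≤ barrierTrace X
      - (1 - 2 * ε) * (barrierGrad X * D).trace + (1 + 2 * ε) * δ * (barrierGrad X).trace := by
  have hdm : d ≤ m / 20 := by nlinarith
  have hX2 : (X - δ • (1 : Matrix ι ι ℝ) + D - D
      - (19 / 20 * m) • (1 : Matrix ι ι ℝ)).PosSemidef := by
    have h : X - δ • (1 : Matrix ι ι ℝ) + D - D - (19 / 20 * m) • (1 : Matrix ι ι ℝ)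
        = X - m • (1 : Matrix ι ι ℝ) + (m / 20 - δ) • (1 : Matrix ι ι ℝ) := by module
    rw [h]
    exact hX.add (PosSemidef.one.smul (by linarith))
  refine (barrierTrace_perturb hm hm2 hε0 hε hd0 hd hX2 hD hDd).2.trans ?_
  obtain ⟨U, x, hU, rfl, hx⟩ := exists_eq_conjDiag_of_le hX
  have hx0 : ∀ i, 0 < x i := fun i => hm.trans_le (hx i)
  have hx1 : ∀ i, 0 < x i - δ := fun i => by linarith [hx i]
  rw [add_sub_cancel_right, conjDiag_sub_smul_one hU, barrierTrace_conjDiag hU hx0,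
    barrierTrace_conjDiag hU hx1, barrierGrad_conjDiag hU hx0, barrierGrad_conjDiag hU hx1,
    trace_conjDiag hU]
  have h1 := trace_conjDiag_mul_mono U
    (fun i => barrierSlope_anti (hx1 i) (sub_le_self (x i) hδ0)) hD
  have h2 : ∑ i, barrier (x i - δ)
      ≤ ∑ i, (barrier (x i) + (1 + 2 * ε) * δ * barrierSlope (x i)) :=
    Finset.sum_le_sum fun i _ =>
      barrier_sub_shift_le hm hm2 hε0 hε (hx i) hδ0 (by linarith)
  rw [Finset.sum_add_distrib, ← Finset.mul_sum] at h2
  have h3 := mul_le_mul_of_nonneg_left h1 (by linarith : 0 ≤ 1 - 2 * ε)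
  linarith

lemma trace_barrierGrad_mul_le {p d : ℝ} (hp : 0 < p)
    (hX : (X - p • (1 : Matrix ι ι ℝ)).PosSemidef)
    (hDd : (d • (1 : Matrix ι ι ℝ) - D).PosSemidef) :
    (barrierGrad X * D).trace ≤ d * (barrierGrad X).trace := by
  have h := trace_barrierGrad_mul_nonneg hp hX hDd
  rwa [Matrix.mul_sub, Matrix.mul_smul, Matrix.mul_one, trace_sub, trace_smul, smul_eq_mul,
    sub_nonneg] at h

end Spectral

lemma minEig_pos_and_posSemidef_sub {n : ℕ} [Nonempty (Fin n)] {M : Matrix (Fin n) (Fin n) ℝ}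
    (hM : M.PosDef) :
    0 < minEig M ∧ (M - minEig M • (1 : Matrix (Fin n) (Fin n) ℝ)).PosSemidef := by
  obtain ⟨U, x, hU, rfl⟩ := exists_eq_conjDiag hM.isHermitian
  have hx := pos_of_posDef_conjDiag hU hM
  have hset : ∀ t : ℝ, (conjDiag U x - t • (1 : Matrix (Fin n) (Fin n) ℝ)).PosSemidef
      ↔ ∀ i, t ≤ x i := fun t => by
    simp only [conjDiag_sub_smul_one hU, posSemidef_conjDiag_iff hU, sub_nonneg]
  obtain ⟨i₀, hi₀⟩ := Finite.exists_min x
  have heq : minEig (conjDiag U x) = x i₀ := by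
    simp only [minEig, hset]
    exact IsGreatest.csSup_eq ⟨hi₀, fun t ht => ht i₀⟩
  rw [heq, hset]
  exact ⟨hx i₀, hi₀⟩

lemma matInner_eq_trace_mul {n : ℕ} (C : Matrix (Fin n) (Fin n) ℝ) {D : Matrix (Fin n) (Fin n) ℝ}
    (hD : D.IsHermitian) : matInner C D = (C * D).trace := by
  simp only [matInner, trace, diag_apply, Matrix.mul_apply]
  refine Finset.sum_congr rfl fun i _ => Finset.sum_congr rfl fun j _ => ?_
  rw [← hD.apply i j, star_trivial]

/-- One step of the barrier argument: if `Δ ⪰ 0`, `Δ ⪯ ερI`, and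
`(C₊ − C₋) • Δ ≥ (ερ/2)((1−β−ε)tr C₊ − (1+β+ε)tr C₋)`, then the potential does not
increase when the barriers are shifted by `δ_u`, `δ_ℓ`. -/
theorem stmt5 {n : ℕ} (β ε : ℝ) (hβ0 : 0 < β) (hβ : β ≤ 1 / 10) (hε0 : 0 < ε)
    (hε : ε ≤ 1 / 10)
    (A : Matrix (Fin n) (Fin n) ℝ) (hAsym : Aᵀ = A)
    (u ℓ ρ : ℝ) (hul : ℓ < u) (hul1 : u - ℓ ≤ 1)
    (hAu : (u • (1 : Matrix (Fin n) (Fin n) ℝ) - A).PosDef)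
    (hAl : (A - ℓ • (1 : Matrix (Fin n) (Fin n) ℝ)).PosDef)
    (hρ1 : (1 - ε) * (min (minEig (u • (1 : Matrix (Fin n) (Fin n) ℝ) - A))
      (minEig (A - ℓ • (1 : Matrix (Fin n) (Fin n) ℝ)))) ^ 2 ≤ ρ)
    (hρ2 : ρ ≤ (min (minEig (u • (1 : Matrix (Fin n) (Fin n) ℝ) - A))
      (minEig (A - ℓ • (1 : Matrix (Fin n) (Fin n) ℝ)))) ^ 2)
    (Cp Cm : Matrix (Fin n) (Fin n) ℝ)
    (hCpdef : Cp = matExp ((A - ℓ • (1 : Matrix (Fin n) (Fin n) ℝ))⁻¹) *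
      ((A - ℓ • (1 : Matrix (Fin n) (Fin n) ℝ))⁻¹) ^ 2)
    (hCmdef : Cm = matExp ((u • (1 : Matrix (Fin n) (Fin n) ℝ) - A)⁻¹) *
      ((u • (1 : Matrix (Fin n) (Fin n) ℝ) - A)⁻¹) ^ 2)
    (Δ : Matrix (Fin n) (Fin n) ℝ) (hΔpsd : Δ.PosSemidef)
    (hΔub : ((ε * ρ) • (1 : Matrix (Fin n) (Fin n) ℝ) - Δ).PosSemidef)
    (hΔip : (ε * ρ / 2) * ((1 - β - ε) * Cp.trace - (1 + β + ε) * Cm.trace) ≤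
      matInner (Cp - Cm) Δ)
    (δu δℓ : ℝ)
    (hδu : δu = (ε * ρ / 2) * (1 + β + 5 * ε) / (1 - 2 * ε))
    (hδℓ : δℓ = (ε * ρ / 2) * (1 - β - 5 * ε) / (1 + 2 * ε)) :
    Phi (u + δu) (ℓ + δℓ) (A + Δ) ≤ Phi u ℓ A := by
  rcases isEmpty_or_nonempty (Fin n) with hn | hn
  · simp [Phi, PhiU, PhiL, trace]
  obtain ⟨hmu, hMu⟩ := minEig_pos_and_posSemidef_sub hAu
  obtain ⟨hml, hMl⟩ := minEig_pos_and_posSemidef_sub hAl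
  set M := u • (1 : Matrix (Fin n) (Fin n) ℝ) - A with hMdef
  set L := A - ℓ • (1 : Matrix (Fin n) (Fin n) ℝ) with hLdef
  set m := min (minEig M) (minEig L)
  have hm : 0 < m := lt_min hmu hml
  replace hMu := sub_smul_one_mono (min_le_left _ _ : m ≤ _) hMu
  replace hMl := sub_smul_one_mono (min_le_right _ _ : m ≤ _) hMl
  have hm2 : m ≤ 1 / 2 := by
    have h : M - m • (1 : Matrix (Fin n) (Fin n) ℝ) + (L - m • (1 : Matrix (Fin n) (Fin n) ℝ))
        = (u - ℓ - 2 * m) • (1 : Matrix (Fin n) (Fin n) ℝ) := by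
      rw [hMdef, hLdef]
      module
    have h1 := hMu.add hMl
    rw [h] at h1
    have h2 := h1.diag_nonneg (i := hn.some)
    rw [Matrix.smul_apply, one_apply_eq, smul_eq_mul] at h2
    linarith
  have hρ : 0 < ρ := lt_of_lt_of_le (mul_pos (by linarith) (pow_pos hm 2)) hρ1
  have hd0 : 0 < ε * ρ := mul_pos hε0 hρ
  have hd : ε * ρ ≤ ε * m ^ 2 := mul_le_mul_of_nonneg_left hρ2 hε0.le
  have eu : (1 - 2 * ε) * δu = ε * ρ / 2 * (1 + β + 5 * ε) := by
    rw [hδu]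
    exact mul_div_cancel₀ _ (by linarith)
  have el : (1 + 2 * ε) * δℓ = ε * ρ / 2 * (1 - β - 5 * ε) := by
    rw [hδℓ]
    exact mul_div_cancel₀ _ (by linarith)
  have hu0 : 0 ≤ δu := by
    rw [hδu]
    exact div_nonneg (by positivity) (by linarith)
  have hu1 : δu ≤ ε * ρ := by
    rw [hδu, div_le_iff₀ (by linarith)]
    nlinarith
  have hl0 : 0 ≤ δℓ := by
    rw [hδℓ]
    exact div_nonneg (mul_nonneg (by positivity) (by linarith)) (by linarith)
  have hl1 : δℓ ≤ ε * ρ / 2 := by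
    rw [hδℓ, div_le_iff₀ (by linarith)]
    exact mul_le_mul_of_nonneg_left (by linarith) (by positivity)
  have hup := barrierTrace_add_sub_le hm hm2 hε0 hε hd0 hd hu0 hu1 hMu hΔpsd hΔub
  have hlo := barrierTrace_sub_add_le hm hm2 hε0 hε hd0 hd hl0 hl1 hMl hΔpsd hΔub
  have hMshift : (u + δu) • (1 : Matrix (Fin n) (Fin n) ℝ) - (A + Δ)
      = M + δu • (1 : Matrix (Fin n) (Fin n) ℝ) - Δ := by
    rw [hMdef]
    module
  have hLshift : A + Δ - (ℓ + δℓ) • (1 : Matrix (Fin n) (Fin n) ℝ)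
      = L - δℓ • (1 : Matrix (Fin n) (Fin n) ℝ) + Δ := by
    rw [hLdef]
    module
  have hnew : Phi (u + δu) (ℓ + δℓ) (A + Δ)
      = barrierTrace (M + δu • (1 : Matrix (Fin n) (Fin n) ℝ) - Δ)
        + barrierTrace (L - δℓ • (1 : Matrix (Fin n) (Fin n) ℝ) + Δ) := by
    rw [← hMshift, ← hLshift]
    rfl
  have hold : Phi u ℓ A = barrierTrace M + barrierTrace L := rfl
  have hCp : Cp = barrierGrad L := hCpdef
  have hCm : Cm = barrierGrad M := hCmdef
  rw [matInner_eq_trace_mul _ hΔpsd.isHermitian, Matrix.sub_mul, trace_sub, hCp, hCm] at hΔip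
  have hp := mul_le_mul_of_nonneg_left (trace_barrierGrad_mul_le hm hMl hΔub) hε0.le
  have hq := mul_le_mul_of_nonneg_left (trace_barrierGrad_mul_le hm hMu hΔub) hε0.le
  rw [eu] at hup
  rw [el] at hlo
  rw [hnew, hold]
  linarith
end

section
/- Let A be a symmetric n×n matrix, ℓ < u barrier values with u − ℓ ≤ 1 and ℓI ≺ A ≺ uI, and 0 < ε ≤ 1/10. Set C₋ = exp((uI−A)^{-1})(uI−A)^{-2} and C₊ = exp((A−ℓI)^{-1})(A−ℓI)^{-2}. Suppose Δ is a symmetric matrix with 0 ⪯ Δ, Δ ⪯ ε(uI−A)², and Δ ⪯ ε(A−ℓI)². Then: Φ_u(A+Δ) ≤ Φ_u(A) + (1+2ε) C₋ • Δ; Φ_ℓ(A+Δ) ≤ Φ_ℓ(A) − (1−2ε) C₊ • Δ; Φ_u(A−Δ) ≤ Φ_u(A) − (1−2ε) C₋ • Δ; and Φ_ℓ(A−Δ) ≤ Φ_ℓ(A) + (1+2ε) C₊ • Δ. -/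
open scoped BigOperators
open Matrix

/-- Second-order remainder bound for the real exponential. -/
lemma exp_sub_one_sub_le (x : ℝ) : Real.exp x - 1 - x ≤ x ^ 2 * (1 / 3 + Real.exp x / 6) := by
  set k : ℝ → ℝ := fun x => (2 * x ^ 2 + 6 * x + 6) * Real.exp (-x) + x ^ 2 with hk
  have hd (y : ℝ) : HasDerivAt k (2 * y * (1 - (1 + y) * Real.exp (-y))) y := by
    have h1 : HasDerivAt (fun x : ℝ => 2 * x ^ 2 + 6 * x + 6) (4 * y + 6) y := by
      have := ((((hasDerivAt_id y).pow 2).const_mul 2).add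
        ((hasDerivAt_id y).const_mul 6)).add_const 6
      refine this.congr_deriv ?_
      simp; ring
    have h2 : HasDerivAt (fun x : ℝ => Real.exp (-x)) (-Real.exp (-y)) y := by
      simpa using (hasDerivAt_id y).neg.exp
    refine ((h1.mul h2).add ((hasDerivAt_id y).pow 2)).congr_deriv ?_
    simp; ring
  have hnn (y : ℝ) : 0 ≤ 1 - (1 + y) * Real.exp (-y) := by
    have h := Real.add_one_le_exp y
    have h3 : Real.exp y * Real.exp (-y) = 1 := by rw [← Real.exp_add]; simp
    nlinarith [Real.exp_pos (-y)]
  have hc : Continuous k := continuous_iff_continuousAt.2 fun y => (hd y).continuousAt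
  have key : k 0 ≤ k x := by
    rcases le_total 0 x with hx | hx
    · refine monotoneOn_of_deriv_nonneg (convex_Ici 0) hc.continuousOn
        (fun y _ => (hd y).differentiableAt.differentiableWithinAt) (fun y hy => ?_)
        Set.self_mem_Ici hx hx
      rw [(hd y).deriv]
      rw [interior_Ici, Set.mem_Ioi] at hy
      exact mul_nonneg (by linarith) (hnn y)
    · refine antitoneOn_of_deriv_nonpos (convex_Iic 0) hc.continuousOn
        (fun y _ => (hd y).differentiableAt.differentiableWithinAt) (fun y hy => ?_)
        hx Set.self_mem_Iic hx
      rw [(hd y).deriv]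
      rw [interior_Iic, Set.mem_Iio] at hy
      exact mul_nonpos_of_nonpos_of_nonneg (by linarith) (hnn y)
  have h3 : Real.exp x * Real.exp (-x) = 1 := by rw [← Real.exp_add]; simp
  have h4 : (6 : ℝ) ≤ (2 * x ^ 2 + 6 * x + 6) * Real.exp (-x) + x ^ 2 := by simpa [hk] using key
  have h5 := mul_le_mul_of_nonneg_left h4 (Real.exp_pos x).le
  linear_combination (1 / 6) * h5 + (1 / 6) * (2 * x ^ 2 + 6 * x + 6) * h3

lemma exp_sub_exp_sub_le (a b : ℝ) :
    Real.exp b - Real.exp a - Real.exp a * (b - a) ≤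
      (b - a) ^ 2 * (Real.exp a / 3 + Real.exp b / 6) := by
  have h := mul_le_mul_of_nonneg_left (exp_sub_one_sub_le (b - a)) (Real.exp_pos a).le
  have h2 : Real.exp a * Real.exp (b - a) = Real.exp b := by rw [← Real.exp_add]; simp
  linear_combination h + (-1 + (b - a) ^ 2 / 6) * h2

lemma exp_tangent_le (a b : ℝ) : Real.exp a * (b - a) ≤ Real.exp b - Real.exp a := by
  have h := mul_le_mul_of_nonneg_left (Real.add_one_le_exp (b - a)) (Real.exp_pos a).le
  have h2 : Real.exp a * Real.exp (b - a) = Real.exp b := by rw [← Real.exp_add]; simp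
  linarith

section TraceInequalities

variable {m : Type*} [Fintype m] [DecidableEq m]

lemma Matrix.IsHermitian.exists_orthogonal_diagonalization {A : Matrix m m ℝ}
    (hA : A.IsHermitian) :
    ∃ (U : Matrix m m ℝ) (a : m → ℝ), Uᵀ * U = 1 ∧ U * Uᵀ = 1 ∧ A = U * diagonal a * Uᵀ := by
  refine ⟨hA.eigenvectorUnitary, hA.eigenvalues, ?_, ?_, ?_⟩
  · exact Unitary.coe_star_mul_self hA.eigenvectorUnitary
  · exact Unitary.coe_mul_star_self hA.eigenvectorUnitary
  · exact hA.spectral_theorem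

lemma conj_diagonal_pow {U : Matrix m m ℝ} (hU : Uᵀ * U = 1) (hU' : U * Uᵀ = 1)
    (a : m → ℝ) (k : ℕ) :
    (U * diagonal a * Uᵀ) ^ k = U * diagonal (fun i => a i ^ k) * Uᵀ := by
  induction k with
  | zero => simp [hU', Matrix.mul_assoc]
  | succ k ih =>
    rw [pow_succ, ih]
    calc _ = U * diagonal (fun i => a i ^ k) * (Uᵀ * U) * diagonal a * Uᵀ := by
          simp only [Matrix.mul_assoc]
      _ = _ := by
          rw [hU, Matrix.mul_one, Matrix.mul_assoc U, diagonal_mul_diagonal]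
          simp only [pow_succ]

lemma exp_conj_diagonal {U : Matrix m m ℝ} (hU : Uᵀ * U = 1) (hU' : U * Uᵀ = 1)
    (a : m → ℝ) :
    NormedSpace.exp (U * diagonal a * Uᵀ) = U * diagonal (fun i => Real.exp (a i)) * Uᵀ := by
  have hinv : U⁻¹ = Uᵀ := inv_eq_left_inv hU
  rw [← hinv, exp_conj U _ (IsUnit.of_mul_eq_one _ hU'), exp_diagonal]
  congr 3
  ext i
  rw [Pi.coe_exp, Real.exp_eq_exp_ℝ]

lemma conj_diagonal_mul {U : Matrix m m ℝ} (hU : Uᵀ * U = 1) (a b : m → ℝ) :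
    (U * diagonal a * Uᵀ) * (U * diagonal b * Uᵀ) =
      U * diagonal (fun i => a i * b i) * Uᵀ := by
  calc _ = U * diagonal a * (Uᵀ * U) * diagonal b * Uᵀ := by simp only [Matrix.mul_assoc]
    _ = _ := by rw [hU, Matrix.mul_one, Matrix.mul_assoc U, diagonal_mul_diagonal]

lemma trace_conj_diagonal_mul (U V : Matrix m m ℝ) (f g : m → ℝ) :
    ((U * diagonal f * Uᵀ) * (V * diagonal g * Vᵀ)).trace =
      ∑ i, ∑ j, (Uᵀ * V) i j ^ 2 * (f i * g j) := by
  have h : ((U * diagonal f * Uᵀ) * (V * diagonal g * Vᵀ)).trace =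
      ((diagonal f * (Uᵀ * V)) * (diagonal g * (Uᵀ * V)ᵀ)).trace := by
    calc _ = (U * (diagonal f * Uᵀ * V * diagonal g * Vᵀ)).trace := by
          simp only [Matrix.mul_assoc]
      _ = _ := by
          rw [trace_mul_comm, transpose_mul, transpose_transpose]
          simp only [Matrix.mul_assoc]
  rw [h, trace]
  refine Finset.sum_congr rfl fun i _ => ?_
  rw [diag_apply, mul_apply]
  refine Finset.sum_congr rfl fun j _ => ?_
  rw [diagonal_mul, diagonal_mul, transpose_apply]
  ring

/-- Mixed traces of two symmetric matrices are weighted sums over pairs of eigenvalues. -/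
lemma exists_joint_spectral_weights {A B : Matrix m m ℝ} (hA : A.IsHermitian)
    (hB : B.IsHermitian) :
    ∃ (a b : m → ℝ) (w : m → m → ℝ), (∀ i j, 0 ≤ w i j) ∧
      (∀ k l : ℕ, (NormedSpace.exp A * A ^ k * B ^ l).trace =
        ∑ i, ∑ j, w i j * (Real.exp (a i) * a i ^ k * b j ^ l)) ∧
      (∀ k l : ℕ, (A ^ k * (NormedSpace.exp B * B ^ l)).trace =
        ∑ i, ∑ j, w i j * (a i ^ k * (Real.exp (b j) * b j ^ l))) := by
  obtain ⟨U, a, hU, hU', rfl⟩ := hA.exists_orthogonal_diagonalization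
  obtain ⟨V, b, hV, hV', rfl⟩ := hB.exists_orthogonal_diagonalization
  refine ⟨a, b, fun i j => (Uᵀ * V) i j ^ 2, fun i j => sq_nonneg _, fun k l => ?_, fun k l => ?_⟩
  · rw [exp_conj_diagonal hU hU', conj_diagonal_pow hU hU', conj_diagonal_pow hV hV',
      conj_diagonal_mul hU, trace_conj_diagonal_mul]
  · rw [exp_conj_diagonal hV hV', conj_diagonal_pow hU hU', conj_diagonal_pow hV hV',
      conj_diagonal_mul hV, trace_conj_diagonal_mul]

/-- Klein's inequality for the exponential. -/
lemma trace_exp_mul_sub_le {A B : Matrix m m ℝ} (hA : A.IsHermitian) (hB : B.IsHermitian) :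
    (NormedSpace.exp A * (B - A)).trace ≤
      (NormedSpace.exp B).trace - (NormedSpace.exp A).trace := by
  obtain ⟨a, b, w, hw, h1, h2⟩ := exists_joint_spectral_weights hA hB
  have e1 := h1 0 1
  have e2 := h1 1 0
  have e3 := h1 0 0
  have e4 := h2 0 0
  simp only [pow_zero, pow_one, mul_one, one_mul] at e1 e2 e3 e4
  rw [Matrix.mul_sub, trace_sub, e1, e2, e3, e4]
  simp only [← Finset.sum_sub_distrib]
  refine Finset.sum_le_sum fun i _ => Finset.sum_le_sum fun j _ => ?_
  have := mul_le_mul_of_nonneg_left (exp_tangent_le (a i) (b j)) (hw i j)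
  linarith

/-- Quantitative second-order upper bound complementing Klein's inequality. -/
lemma trace_exp_sub_le {A B : Matrix m m ℝ} (hA : A.IsHermitian) (hB : B.IsHermitian) :
    (NormedSpace.exp B).trace - (NormedSpace.exp A).trace ≤
      (NormedSpace.exp A * (B - A)).trace +
        (NormedSpace.exp A * (B - A) ^ 2).trace / 3 +
        (NormedSpace.exp B * (B - A) ^ 2).trace / 6 := by
  obtain ⟨a, b, w, hw, h1, h2⟩ := exists_joint_spectral_weights hA hB
  have cA : (NormedSpace.exp A * (B * A)).trace = (NormedSpace.exp A * A * B).trace := by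
    rw [← Matrix.mul_assoc, trace_mul_comm, ← Matrix.mul_assoc,
      ((Commute.refl A).exp_right).eq]
  have cB : (NormedSpace.exp B * (A * B)).trace = (NormedSpace.exp B * (B * A)).trace := by
    rw [← Matrix.mul_assoc, trace_mul_comm, ← Matrix.mul_assoc, ← Matrix.mul_assoc,
      ((Commute.refl B).exp_right).eq]
  have cB' : (NormedSpace.exp B * (B * A)).trace = (A * (NormedSpace.exp B * B)).trace := by
    rw [← Matrix.mul_assoc, trace_mul_comm]
  have cB'' : (NormedSpace.exp B * (A * A)).trace = (A * A * NormedSpace.exp B).trace := by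
    rw [trace_mul_comm]
  have sq : (B - A) ^ 2 = B * B - B * A - A * B + A * A := by noncomm_ring
  have e1 := h1 0 1
  have e2 := h1 1 0
  have e3 := h1 0 0
  have e4 := h2 0 0
  have e5 := h1 0 2
  have e6 := h1 1 1
  have e7 := h1 2 0
  have e8 := h2 2 0
  have e9 := h2 1 1
  have e10 := h2 0 2
  simp only [pow_zero, pow_one, mul_one, one_mul,
    pow_two] at e1 e2 e3 e4 e5 e6 e7 e8 e9 e10
  rw [sq]
  simp only [Matrix.mul_sub, Matrix.mul_add, trace_sub, trace_add]
  rw [cB, cB', cB'', cA, ← Matrix.mul_assoc _ A B, e1, e2, e3, e4, e5,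
    e6, e7, e8, e9, e10]
  simp only [← Finset.sum_sub_distrib, ← Finset.sum_add_distrib, Finset.sum_div]
  refine Finset.sum_le_sum fun i _ => Finset.sum_le_sum fun j _ => ?_
  have := mul_le_mul_of_nonneg_left (exp_sub_exp_sub_le (a i) (b j)) (hw i j)
  linarith

lemma trace_exp_mul_nonneg {A Z : Matrix m m ℝ} (hA : A.IsHermitian) (hZ : Z.PosSemidef) :
    0 ≤ (NormedSpace.exp A * Z).trace := by
  obtain ⟨U, a, hU, hU', rfl⟩ := hA.exists_orthogonal_diagonalization
  rw [exp_conj_diagonal hU hU']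
  have h := hZ.conjTranspose_mul_mul_same U
  rw [Matrix.mul_assoc, Matrix.mul_assoc, trace_mul_comm, Matrix.mul_assoc, trace]
  refine Finset.sum_nonneg fun i _ => ?_
  rw [diag_apply, diagonal_mul]
  exact mul_nonneg (Real.exp_pos _).le h.diag_nonneg

end TraceInequalities

section Barrier

variable {m : Type*} [Fintype m] [DecidableEq m]

lemma Matrix.PosSemidef.smul_sub_sq {Y : Matrix m m ℝ} (hY : Y.PosSemidef) {κ : ℝ} (hκ : 0 < κ)
    (hYκ : (κ • (1 : Matrix m m ℝ) - Y).PosSemidef) : (κ • Y - Y ^ 2).PosSemidef := by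
  have h1 := hYκ.conjTranspose_mul_mul_same Y
  have h2 := hY.conjTranspose_mul_mul_same (κ • (1 : Matrix m m ℝ) - Y)
  rw [hY.1.eq] at h1
  rw [hYκ.1.eq] at h2
  have h := (h1.add h2).smul (inv_nonneg.2 hκ.le)
  convert h using 1
  have e : Y * (κ • 1 - Y) * Y + (κ • 1 - Y) * Y * (κ • 1 - Y) = κ • (κ • Y - Y ^ 2) := by
    simp only [mul_sub, sub_mul, mul_smul_comm, smul_mul_assoc, mul_one, one_mul, smul_sub,
      pow_two, Matrix.mul_assoc]
    abel
  rw [e, smul_smul, inv_mul_cancel₀ hκ.ne', one_smul]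

lemma Matrix.PosSemidef.smul_sub_mul_inv_mul {D P : Matrix m m ℝ} (hD : D.PosSemidef)
    (hP : P.PosDef) {κ : ℝ} (hκ : 0 < κ) (h : (κ • P - D).PosSemidef) :
    (κ • D - D * P⁻¹ * D).PosSemidef := by
  have hdet : IsUnit P.det := (Matrix.isUnit_iff_isUnit_det P).1 hP.isUnit
  have hPi : P⁻¹ * P = 1 := nonsing_inv_mul P hdet
  have hPH : (P⁻¹)ᴴ = P⁻¹ := hP.inv.1
  have h1 := hD.conjTranspose_mul_mul_same (P⁻¹ * D - κ • (1 : Matrix m m ℝ))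
  have h2 := h.conjTranspose_mul_mul_same (P⁻¹ * D)
  convert (h1.add h2).smul (inv_nonneg.2 hκ.le) using 1
  have e : (P⁻¹ * D - κ • (1 : Matrix m m ℝ))ᴴ * D * (P⁻¹ * D - κ • (1 : Matrix m m ℝ)) +
      (P⁻¹ * D)ᴴ * (κ • P - D) * (P⁻¹ * D) = κ • (κ • D - D * P⁻¹ * D) := by
    have e1 : D * (P⁻¹ * (P * (P⁻¹ * D))) = D * (P⁻¹ * D) := by
      rw [← Matrix.mul_assoc P⁻¹ P, hPi, Matrix.one_mul]
    simp only [conjTranspose_sub, conjTranspose_mul, conjTranspose_smul, conjTranspose_one, hPH,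
      hD.1.eq, mul_sub, sub_mul, mul_smul_comm, smul_mul_assoc, mul_one, one_mul, smul_sub,
      Matrix.mul_assoc, star_trivial, e1]
    abel
  rw [e, smul_smul, inv_mul_cancel₀ hκ.ne', one_smul]

lemma trace_exp_mul_sq_le {X Y : Matrix m m ℝ} (hX : X.IsHermitian) (hY : Y.PosSemidef) {κ : ℝ}
    (hκ : 0 < κ) (hYκ : (κ • (1 : Matrix m m ℝ) - Y).PosSemidef) :
    (NormedSpace.exp X * Y ^ 2).trace ≤ κ * (NormedSpace.exp X * Y).trace := by
  have h := trace_exp_mul_nonneg hX (hY.smul_sub_sq hκ hYκ)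
  rw [Matrix.mul_sub, trace_sub, mul_smul_comm, trace_smul, smul_eq_mul] at h
  linarith

lemma trace_exp_add_sub_le {X Y : Matrix m m ℝ} (hX : X.IsHermitian) (hY : Y.PosSemidef) {κ : ℝ}
    (hκ : 0 < κ) (hκ' : κ ≤ 1 / 9) (hYκ : (κ • (1 : Matrix m m ℝ) - Y).PosSemidef) :
    (NormedSpace.exp (X + Y)).trace - (NormedSpace.exp X).trace ≤
      (1 + 53 / 100 * κ) * (NormedSpace.exp X * Y).trace := by
  have hXY : (X + Y).IsHermitian := hX.add hY.1
  have h1 := trace_exp_sub_le hX hXY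
  have h2 := trace_exp_sub_le hXY hX
  have hs : X + Y - X = Y := by abel
  have hs' : X - (X + Y) = -Y := by abel
  rw [hs] at h1
  rw [hs', neg_sq, Matrix.mul_neg, trace_neg] at h2
  have h3 := trace_exp_mul_sq_le hX hY hκ hYκ
  have h4 := trace_exp_mul_sq_le hXY hY hκ hYκ
  have h5 := trace_exp_mul_nonneg hX hY
  have h6 := trace_exp_mul_nonneg hXY hY
  set p := (NormedSpace.exp X * Y).trace
  set q := (NormedSpace.exp (X + Y) * Y).trace
  set d := (NormedSpace.exp (X + Y)).trace - (NormedSpace.exp X).trace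
  have hd1 : d ≤ p + κ * p / 3 + κ * q / 6 := by linarith
  have hd2 : q ≤ d + κ * q / 3 + κ * p / 6 := by linarith
  have hq : q ≤ 27 / 26 * (d + p / 54) := by nlinarith
  have hd3 : d ≤ p + κ * p / 3 + κ / 6 * (27 / 26 * (d + p / 54)) := by nlinarith
  have hc : 0 < 1 - 27 / 156 * κ := by linarith
  refine le_of_mul_le_mul_left ?_ hc
  nlinarith [mul_nonneg hκ.le h5, mul_nonneg (mul_nonneg hκ.le h5) (sub_nonneg.2 hκ')]

lemma le_trace_exp_sub_trace_exp_sub {X Y : Matrix m m ℝ} (hX : X.IsHermitian)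
    (hY : Y.PosSemidef) {κ : ℝ} (hκ : 0 < κ)
    (hYκ : (κ • (1 : Matrix m m ℝ) - Y).PosSemidef) :
    (1 - κ / 2) * (NormedSpace.exp X * Y).trace ≤
      (NormedSpace.exp X).trace - (NormedSpace.exp (X - Y)).trace := by
  have hXY : (X - Y).IsHermitian := hX.sub hY.1
  have h1 := trace_exp_sub_le hX hXY
  have h2 := trace_exp_mul_sub_le hXY hX
  have hs : X - Y - X = -Y := by abel
  have hs' : X - (X - Y) = Y := by abel
  rw [hs, neg_sq, Matrix.mul_neg, trace_neg] at h1
  rw [hs'] at h2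
  have h3 := trace_exp_mul_sq_le hX hY hκ hYκ
  have h4 := trace_exp_mul_sq_le hXY hY hκ hYκ
  have h5 := trace_exp_mul_nonneg hX hY
  set p := (NormedSpace.exp X * Y).trace
  set q := (NormedSpace.exp (X - Y) * Y).trace
  set d := (NormedSpace.exp X).trace - (NormedSpace.exp (X - Y)).trace
  have hd1 : p ≤ d + κ * p / 3 + κ * q / 6 := by linarith
  have hd2 : p ≤ d + κ * p / 3 + κ * d / 6 := by nlinarith
  have hc : 0 < 1 + κ / 6 := by linarith
  refine le_of_mul_le_mul_left ?_ hc
  nlinarith [mul_nonneg (mul_nonneg hκ.le h5) hκ.le]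

/-- Second-order resolvent expansion. -/
lemma inv_sub_inv_eq_resolvent {M P : Matrix m m ℝ} (hM : IsUnit M.det) (hP : IsUnit P.det) :
    P⁻¹ - M⁻¹ = M⁻¹ * (M - P) * M⁻¹ + M⁻¹ * ((M - P) * P⁻¹ * (M - P)) * M⁻¹ := by
  have h1 : P⁻¹ - M⁻¹ = M⁻¹ * (M - P) * P⁻¹ := by
    rw [Matrix.mul_sub, Matrix.sub_mul, nonsing_inv_mul M hM, Matrix.one_mul, Matrix.mul_assoc,
      mul_nonsing_inv P hP, Matrix.mul_one]
  have h2 : P⁻¹ - M⁻¹ = P⁻¹ * (M - P) * M⁻¹ := by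
    rw [Matrix.mul_sub, Matrix.sub_mul, nonsing_inv_mul P hP, Matrix.one_mul, Matrix.mul_assoc,
      mul_nonsing_inv M hM, Matrix.mul_one]
  have h3 : P⁻¹ = M⁻¹ + P⁻¹ * (M - P) * M⁻¹ := by rw [← h2]; abel
  calc P⁻¹ - M⁻¹ = M⁻¹ * (M - P) * P⁻¹ := h1
    _ = M⁻¹ * (M - P) * (M⁻¹ + P⁻¹ * (M - P) * M⁻¹) := by rw [← h3]
    _ = _ := by simp only [Matrix.mul_add, Matrix.mul_assoc]

variable {M Δ : Matrix m m ℝ} {ε : ℝ}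

lemma smul_sub_posSemidef_of_sq (hε0 : 0 < ε) (hM : M.PosDef)
    (hM1 : ((1 : Matrix m m ℝ) - M).PosSemidef)
    (hΔM : (ε • M ^ 2 - Δ).PosSemidef) : (ε • M - Δ).PosSemidef := by
  have h := hM.posSemidef.smul_sub_sq one_pos (by rwa [one_smul])
  convert (h.smul hε0.le).add hΔM using 1
  simp only [one_smul, smul_sub]
  abel

lemma Matrix.PosDef.inv_mul_mul_inv_posSemidef (hM : M.PosDef) {D : Matrix m m ℝ}
    (hD : D.PosSemidef) : (M⁻¹ * D * M⁻¹).PosSemidef := by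
  have h := hD.conjTranspose_mul_mul_same M⁻¹
  rwa [hM.inv.1.eq] at h

lemma smul_one_sub_inv_mul_mul_inv_posSemidef (hM : M.PosDef)
    (hΔM : (ε • M ^ 2 - Δ).PosSemidef) :
    (ε • (1 : Matrix m m ℝ) - M⁻¹ * Δ * M⁻¹).PosSemidef := by
  have hdet : IsUnit M.det := (Matrix.isUnit_iff_isUnit_det M).1 hM.isUnit
  have h := hM.inv_mul_mul_inv_posSemidef hΔM
  convert h using 1
  rw [Matrix.mul_sub, Matrix.sub_mul, mul_smul_comm, smul_mul_assoc, pow_two, ← Matrix.mul_assoc,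
    nonsing_inv_mul M hdet, Matrix.one_mul, mul_nonsing_inv M hdet]

lemma trace_exp_inv_sub_le (hε0 : 0 < ε) (hε : ε ≤ 1 / 10) (hM : M.PosDef)
    (hM1 : ((1 : Matrix m m ℝ) - M).PosSemidef) (hΔ : Δ.PosSemidef)
    (hΔM : (ε • M ^ 2 - Δ).PosSemidef) :
    (NormedSpace.exp (M - Δ)⁻¹).trace ≤ (NormedSpace.exp M⁻¹).trace +
      (1 + 2 * ε) * (NormedSpace.exp M⁻¹ * (M⁻¹ * Δ * M⁻¹)).trace := by
  have hε1 : 0 < 1 - ε := by linarith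
  have hlin := smul_sub_posSemidef_of_sq hε0 hM hM1 hΔM
  have hP : (M - Δ).PosDef := by
    convert (hM.smul hε1).add_posSemidef hlin using 1
    rw [sub_smul, one_smul]; abel
  have hκ : 0 < ε / (1 - ε) := by positivity
  have hκ' : ε / (1 - ε) ≤ 1 / 9 := by rw [div_le_iff₀ hε1]; linarith
  have hκP : ((ε / (1 - ε)) • (M - Δ) - Δ).PosSemidef := by
    convert hlin.smul (inv_nonneg.2 hε1.le) using 1
    ext i j
    simp
    field_simp
    ring
  have hres := hM.inv_mul_mul_inv_posSemidef (hΔ.smul_sub_mul_inv_mul hP hκ hκP)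
  have hdM : IsUnit M.det := (Matrix.isUnit_iff_isUnit_det M).1 hM.isUnit
  have hdP : IsUnit (M - Δ).det := (Matrix.isUnit_iff_isUnit_det _).1 hP.isUnit
  have hY := inv_sub_inv_eq_resolvent hdM hdP
  rw [sub_sub_cancel] at hY
  have hR := hM.inv_mul_mul_inv_posSemidef hΔ
  have hRε := smul_one_sub_inv_mul_mul_inv_posSemidef hM hΔM
  have hquad : (Δ * (M - Δ)⁻¹ * Δ).PosSemidef := by
    have h := hP.inv.posSemidef.conjTranspose_mul_mul_same Δ
    rwa [hΔ.1.eq] at h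
  have hYpsd : ((M - Δ)⁻¹ - M⁻¹).PosSemidef := by
    rw [hY]; exact hR.add (hM.inv_mul_mul_inv_posSemidef hquad)
  have hYR : ((1 - ε)⁻¹ • (M⁻¹ * Δ * M⁻¹) - ((M - Δ)⁻¹ - M⁻¹)).PosSemidef := by
    rw [hY]
    convert hres using 1
    have : (1 - ε)⁻¹ = 1 + ε / (1 - ε) := by field_simp; ring
    rw [this, add_smul, one_smul, Matrix.mul_sub, Matrix.sub_mul, mul_smul_comm, smul_mul_assoc]
    abel
  have hYκ : ((ε / (1 - ε)) • (1 : Matrix m m ℝ) - ((M - Δ)⁻¹ - M⁻¹)).PosSemidef := by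
    convert (hRε.smul (inv_nonneg.2 hε1.le)).add hYR using 1
    rw [smul_sub, smul_smul, inv_mul_eq_div]
    abel
  have hX : M⁻¹.IsHermitian := hM.inv.1
  have h1 := trace_exp_add_sub_le hX hYpsd hκ hκ' hYκ
  rw [add_sub_cancel] at h1
  have h2 := trace_exp_mul_nonneg hX hYR
  rw [Matrix.mul_sub, trace_sub, mul_smul_comm, trace_smul, smul_eq_mul] at h2
  have h3 := trace_exp_mul_nonneg hX hR
  set r := (NormedSpace.exp M⁻¹ * (M⁻¹ * Δ * M⁻¹)).trace
  set p := (NormedSpace.exp M⁻¹ * ((M - Δ)⁻¹ - M⁻¹)).trace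
  have hcoef : (1 + 53 / 100 * (ε / (1 - ε))) * (1 - ε)⁻¹ ≤ 1 + 2 * ε := by
    rw [← div_eq_mul_inv, div_le_iff₀ hε1, ← le_sub_iff_add_le', mul_div_assoc',
      div_le_iff₀ hε1]
    nlinarith [mul_pos hε0 hε0, mul_pos (mul_pos hε0 hε0) hε0]
  have h5 := mul_le_mul_of_nonneg_left (sub_nonneg.1 h2)
    (by positivity : 0 ≤ 1 + 53 / 100 * (ε / (1 - ε)))
  have h6 := mul_le_mul_of_nonneg_right hcoef h3
  linarith

lemma trace_exp_inv_add_le (hε0 : 0 < ε) (hε : ε ≤ 1 / 10) (hM : M.PosDef)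
    (hM1 : ((1 : Matrix m m ℝ) - M).PosSemidef) (hΔ : Δ.PosSemidef)
    (hΔM : (ε • M ^ 2 - Δ).PosSemidef) :
    (NormedSpace.exp (M + Δ)⁻¹).trace ≤ (NormedSpace.exp M⁻¹).trace -
      (1 - 2 * ε) * (NormedSpace.exp M⁻¹ * (M⁻¹ * Δ * M⁻¹)).trace := by
  have hlin := smul_sub_posSemidef_of_sq hε0 hM hM1 hΔM
  have hP : (M + Δ).PosDef := hM.add_posSemidef hΔ
  have hκP : (ε • (M + Δ) - Δ).PosSemidef := by
    convert hlin.add (hΔ.smul hε0.le) using 1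
    rw [smul_add]; abel
  have hres := hM.inv_mul_mul_inv_posSemidef (hΔ.smul_sub_mul_inv_mul hP hε0 hκP)
  have hdM : IsUnit M.det := (Matrix.isUnit_iff_isUnit_det M).1 hM.isUnit
  have hdP : IsUnit (M + Δ).det := (Matrix.isUnit_iff_isUnit_det _).1 hP.isUnit
  have hY : M⁻¹ - (M + Δ)⁻¹ = M⁻¹ * Δ * M⁻¹ - M⁻¹ * (Δ * (M + Δ)⁻¹ * Δ) * M⁻¹ := by
    have h := inv_sub_inv_eq_resolvent hdM hdP
    rw [sub_add_cancel_left] at h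
    rw [← neg_sub, h]
    simp only [Matrix.mul_neg, Matrix.neg_mul, neg_neg]
    abel
  have hR := hM.inv_mul_mul_inv_posSemidef hΔ
  have hRε := smul_one_sub_inv_mul_mul_inv_posSemidef hM hΔM
  have hquad : (Δ * (M + Δ)⁻¹ * Δ).PosSemidef := by
    have h := hP.inv.posSemidef.conjTranspose_mul_mul_same Δ
    rwa [hΔ.1.eq] at h
  have hYR : ((M⁻¹ - (M + Δ)⁻¹) - (1 - ε) • (M⁻¹ * Δ * M⁻¹)).PosSemidef := by
    rw [hY]
    convert hres using 1
    rw [sub_smul, one_smul, Matrix.mul_sub, Matrix.sub_mul, mul_smul_comm, smul_mul_assoc]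
    abel
  have hYpsd : (M⁻¹ - (M + Δ)⁻¹).PosSemidef := by
    convert hYR.add (hR.smul (by linarith : 0 ≤ 1 - ε)) using 1
    abel
  have hYε : (ε • (1 : Matrix m m ℝ) - (M⁻¹ - (M + Δ)⁻¹)).PosSemidef := by
    rw [hY]
    convert hRε.add (hM.inv_mul_mul_inv_posSemidef hquad) using 1
    abel
  have hX : M⁻¹.IsHermitian := hM.inv.1
  have h1 := le_trace_exp_sub_trace_exp_sub hX hYpsd hε0 hYε
  rw [sub_sub_cancel] at h1
  have h2 := trace_exp_mul_nonneg hX hYR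
  rw [Matrix.mul_sub, trace_sub, mul_smul_comm, trace_smul, smul_eq_mul] at h2
  have h3 := trace_exp_mul_nonneg hX hR
  set r := (NormedSpace.exp M⁻¹ * (M⁻¹ * Δ * M⁻¹)).trace
  have h5 := mul_le_mul_of_nonneg_left (sub_nonneg.1 h2) (by linarith : 0 ≤ 1 - ε / 2)
  nlinarith [mul_nonneg hε0.le h3, mul_nonneg (mul_nonneg hε0.le hε0.le) h3]

end Barrier

lemma matInner_exp_mul_inv_sq {n : ℕ} (M Δ : Matrix (Fin n) (Fin n) ℝ) (hΔ : Δᵀ = Δ) :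
    matInner (matExp M⁻¹ * M⁻¹ ^ 2) Δ =
      (NormedSpace.exp M⁻¹ * (M⁻¹ * Δ * M⁻¹)).trace := by
  have h (C : Matrix (Fin n) (Fin n) ℝ) : matInner C Δ = (C * Δ).trace := by
    conv_rhs => rw [← hΔ]
    simp [matInner, trace, mul_apply]
  rw [h, matExp, ← Matrix.mul_assoc _ _ M⁻¹, trace_mul_comm _ M⁻¹, ← Matrix.mul_assoc,
    ← ((Commute.refl M⁻¹).exp_left).eq, pow_two]
  simp only [Matrix.mul_assoc]

/-- First-order accuracy of the barrier potentials for small shifts `Δ`. -/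
theorem stmt6 {n : ℕ} (ε : ℝ) (hε0 : 0 < ε) (hε : ε ≤ 1 / 10)
    (A : Matrix (Fin n) (Fin n) ℝ) (hAsym : Aᵀ = A)
    (u ℓ : ℝ) (hul : ℓ < u) (hul1 : u - ℓ ≤ 1)
    (hAu : (u • (1 : Matrix (Fin n) (Fin n) ℝ) - A).PosDef)
    (hAl : (A - ℓ • (1 : Matrix (Fin n) (Fin n) ℝ)).PosDef)
    (Cp Cm : Matrix (Fin n) (Fin n) ℝ)
    (hCpdef : Cp = matExp ((A - ℓ • (1 : Matrix (Fin n) (Fin n) ℝ))⁻¹) *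
      ((A - ℓ • (1 : Matrix (Fin n) (Fin n) ℝ))⁻¹) ^ 2)
    (hCmdef : Cm = matExp ((u • (1 : Matrix (Fin n) (Fin n) ℝ) - A)⁻¹) *
      ((u • (1 : Matrix (Fin n) (Fin n) ℝ) - A)⁻¹) ^ 2)
    (Δ : Matrix (Fin n) (Fin n) ℝ) (hΔsym : Δᵀ = Δ) (hΔpsd : Δ.PosSemidef)
    (hΔu : (ε • (u • (1 : Matrix (Fin n) (Fin n) ℝ) - A) ^ 2 - Δ).PosSemidef)
    (hΔl : (ε • (A - ℓ • (1 : Matrix (Fin n) (Fin n) ℝ)) ^ 2 - Δ).PosSemidef) :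
    PhiU u (A + Δ) ≤ PhiU u A + (1 + 2 * ε) * matInner Cm Δ ∧
    PhiL ℓ (A + Δ) ≤ PhiL ℓ A - (1 - 2 * ε) * matInner Cp Δ ∧
    PhiU u (A - Δ) ≤ PhiU u A - (1 - 2 * ε) * matInner Cm Δ ∧
    PhiL ℓ (A - Δ) ≤ PhiL ℓ A + (1 + 2 * ε) * matInner Cp Δ := by
  have key1 : ((1 : Matrix (Fin n) (Fin n) ℝ) - (u • 1 - A)).PosSemidef := by
    convert hAl.posSemidef.add
      ((PosSemidef.one (n := Fin n) (R := ℝ)).smul (by linarith : 0 ≤ 1 - (u - ℓ))) using 1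
    rw [sub_smul, sub_smul, one_smul]
    abel
  have key2 : ((1 : Matrix (Fin n) (Fin n) ℝ) - (A - ℓ • 1)).PosSemidef := by
    convert hAu.posSemidef.add
      ((PosSemidef.one (n := Fin n) (R := ℝ)).smul (by linarith : 0 ≤ 1 - (u - ℓ))) using 1
    rw [sub_smul, sub_smul, one_smul]
    abel
  subst hCpdef hCmdef
  rw [matInner_exp_mul_inv_sq _ _ hΔsym, matInner_exp_mul_inv_sq _ _ hΔsym]
  simp only [PhiU, PhiL, matExp]
  refine ⟨?_, ?_, ?_, ?_⟩
  · rw [← sub_sub]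
    exact trace_exp_inv_sub_le hε0 hε hAu key1 hΔpsd hΔu
  · rw [add_sub_right_comm]
    exact trace_exp_inv_add_le hε0 hε hAl key2 hΔpsd hΔl
  · rw [← sub_add]
    exact trace_exp_inv_add_le hε0 hε hAu key1 hΔpsd hΔu
  · rw [sub_right_comm]
    exact trace_exp_inv_sub_le hε0 hε hAl key2 hΔpsd hΔl
end
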